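/- arXiv:1305.3788 — 3 statements merged into one kernel-verified Lean document; each statement's English description precedes it below -/
import Mathlib

section
/- Let U : ℝ³ → ℝ be a smooth potential and H(x,y) = ½⟨y,y⟩_L + U(x). Then at every point of V = {(x,y) ∈ ℝ³×ℝ³ : ⟨x,x⟩_L + 1 = 0 and ⟨x,y⟩_L = 0} one has {x_i,H}* = y_i for i = 1,2,3, and {y_i,H}* equals the i-th component of −∇_L U(x) + x·(⟨y,y⟩_L − ⟨x, ∇_L U(x)⟩_L); that is, the Hamiltonian equations for H with respect to the Dirac–Poisson bracket on V are ẋ = y, ẏ = −∇_L U(x) + x(⟨y,y⟩_L − ⟨x, ∇_L U(x)⟩_L). -/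
noncomputable section

/-- Points of `ℝ³`. -/
abbrev V3 : Type := Fin 3 → ℝ

/-- Phase space `ℝ³ × ℝ³` with coordinates `(x, y)`. -/
abbrev Phase : Type := V3 × V3

/-- The Lorentz pseudo inner product `⟨u,v⟩_L = u₁v₁ + u₂v₂ − u₃v₃`. -/
def Lprod (u v : V3) : ℝ := u 0 * v 0 + u 1 * v 1 - u 2 * v 2

/-- Sign pattern of the Lorentz gradient. -/
def sgn3 (i : Fin 3) : ℝ := if i = 2 then -1 else 1

/-- The Lorentz gradient `∇_L f = (∂₁f, ∂₂f, −∂₃f)` of a scalar field on `ℝ³`. -/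
def Lgrad (U : V3 → ℝ) (x : V3) : V3 :=
  fun i => sgn3 i * fderiv ℝ U x (Pi.single i 1 : V3)

/-- The Lorentz gradient with respect to the `x`-variables. -/
def Lgradx (f : Phase → ℝ) (z : Phase) : V3 :=
  fun i => sgn3 i * fderiv ℝ f z ((Pi.single i 1 : V3), (0 : V3))

/-- The Lorentz gradient with respect to the `y`-variables. -/
def Lgrady (f : Phase → ℝ) (z : Phase) : V3 :=
  fun i => sgn3 i * fderiv ℝ f z ((0 : V3), (Pi.single i 1 : V3))

/-- The Poisson bracket `{f,g} = ⟨∇_L^x f, ∇_L^y g⟩_L − ⟨∇_L^x g, ∇_L^y f⟩_L`. -/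
def pb (f g : Phase → ℝ) (z : Phase) : ℝ :=
  Lprod (Lgradx f z) (Lgrady g z) - Lprod (Lgradx g z) (Lgrady f z)

/-- The first constraint `c₁(x,y) = ⟨x,x⟩_L + 1`. -/
def c1 (z : Phase) : ℝ := Lprod z.1 z.1 + 1

/-- The second constraint `c₂(x,y) = ⟨x,y⟩_L`. -/
def c2 (z : Phase) : ℝ := Lprod z.1 z.2

/-- The Dirac–Poisson bracket
`{f,g}* = {f,g} + (1/(2⟨x,x⟩_L))({f,c₂}{g,c₁} − {f,c₁}{g,c₂})`. -/
def dpb (f g : Phase → ℝ) (z : Phase) : ℝ :=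
  pb f g z + (1 / (2 * Lprod z.1 z.1)) * (pb f c2 z * pb g c1 z - pb f c1 z * pb g c2 z)

theorem Lprod_comm (u v : V3) : Lprod u v = Lprod v u := by
  simp only [Lprod]; ring

theorem Lprod_sgn3_mul_single_left (i : Fin 3) (v : V3) :
    Lprod (fun j => sgn3 j * (Pi.single i 1 : V3) j) v = v i := by
  fin_cases i <;> simp [Lprod, sgn3]

theorem sgn3_mul_Lprod_single (i : Fin 3) (v : V3) :
    sgn3 i * Lprod (Pi.single i 1) v = v i := by
  fin_cases i <;> simp [Lprod, sgn3]

theorem Lprod_zero_left (v : V3) : Lprod 0 v = 0 := by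
  simp [Lprod]

theorem Lprod_zero_right (v : V3) : Lprod v 0 = 0 := by
  simp [Lprod]

theorem Lprod_smul_left (a : ℝ) (u v : V3) : Lprod (a • u) v = a * Lprod u v := by
  simp only [Lprod, Pi.smul_apply, smul_eq_mul]; ring

theorem differentiable_Lprod (A B : Phase →L[ℝ] V3) :
    Differentiable ℝ fun w => Lprod (A w) (B w) := by
  unfold Lprod
  fun_prop

/-- The Leibniz rule for the Lorentz product of two linear maps. -/
theorem fderiv_Lprod (A B : Phase →L[ℝ] V3) (z v : Phase) :
    fderiv ℝ (fun w => Lprod (A w) (B w)) z v = Lprod (A v) (B z) + Lprod (B v) (A z) := by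
  have hA (i : Fin 3) : HasFDerivAt (fun w => A w i) ((ContinuousLinearMap.proj i).comp A) z :=
    ((ContinuousLinearMap.proj (R := ℝ) (φ := fun _ : Fin 3 => ℝ) i).comp A).hasFDerivAt
  have hB (i : Fin 3) : HasFDerivAt (fun w => B w i) ((ContinuousLinearMap.proj i).comp B) z :=
    ((ContinuousLinearMap.proj (R := ℝ) (φ := fun _ : Fin 3 => ℝ) i).comp B).hasFDerivAt
  have h : HasFDerivAt (fun w => Lprod (A w) (B w)) _ z :=
    (((hA 0).mul (hB 0)).add ((hA 1).mul (hB 1))).sub ((hA 2).mul (hB 2))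
  rw [h.fderiv]
  simp [Lprod]
  ring

theorem fderiv_c1 (z v : Phase) : fderiv ℝ c1 z v = 2 * Lprod v.1 z.1 := by
  have h := fderiv_Lprod (.fst ℝ V3 V3) (.fst ℝ V3 V3) z v
  have e : c1 = fun w => Lprod w.1 w.1 + 1 := rfl
  rw [e, fderiv_add_const]
  exact h.trans (two_mul _).symm

theorem fderiv_c2 (z v : Phase) : fderiv ℝ c2 z v = Lprod v.1 z.2 + Lprod v.2 z.1 :=
  fderiv_Lprod (.fst ℝ V3 V3) (.snd ℝ V3 V3) z v

theorem fderiv_hamiltonian {U : V3 → ℝ} {z : Phase} (hU : DifferentiableAt ℝ U z.1)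
    (v : Phase) :
    fderiv ℝ (fun w : Phase => (1/2) * Lprod w.2 w.2 + U w.1) z v =
      Lprod v.2 z.2 + fderiv ℝ U z.1 v.1 := by
  have hd : DifferentiableAt ℝ (fun w : Phase => Lprod w.2 w.2) z :=
    differentiable_Lprod (.snd ℝ V3 V3) (.snd ℝ V3 V3) z
  have hf : fderiv ℝ (fun w : Phase => Lprod w.2 w.2) z v = Lprod v.2 z.2 + Lprod v.2 z.2 :=
    fderiv_Lprod (.snd ℝ V3 V3) (.snd ℝ V3 V3) z v
  have hc : HasFDerivAt (fun w : Phase => U w.1) _ z :=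
    hU.hasFDerivAt.comp z (ContinuousLinearMap.fst ℝ V3 V3).hasFDerivAt
  have h := (hd.hasFDerivAt.const_mul (1/2)).add hc
  refine (congrArg (fun L => L v) h.fderiv).trans ?_
  simp [hf]
  ring

theorem Lgradx_c1 (z : Phase) : Lgradx c1 z = (2 : ℝ) • z.1 := by
  ext i
  simp only [Lgradx, fderiv_c1, Pi.smul_apply, smul_eq_mul]
  rw [mul_left_comm, sgn3_mul_Lprod_single]

theorem Lgrady_c1 (z : Phase) : Lgrady c1 z = 0 := by
  ext i
  simp [Lgrady, fderiv_c1, Lprod_zero_left]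

theorem Lgradx_c2 (z : Phase) : Lgradx c2 z = z.2 := by
  ext i
  simp [Lgradx, fderiv_c2, Lprod_zero_left, sgn3_mul_Lprod_single]

theorem Lgrady_c2 (z : Phase) : Lgrady c2 z = z.1 := by
  ext i
  simp [Lgrady, fderiv_c2, Lprod_zero_left, sgn3_mul_Lprod_single]

theorem Lgradx_hamiltonian {U : V3 → ℝ} {z : Phase} (hU : DifferentiableAt ℝ U z.1) :
    Lgradx (fun w => (1/2) * Lprod w.2 w.2 + U w.1) z = Lgrad U z.1 := by
  ext i
  simp only [Lgradx, fderiv_hamiltonian hU, Lprod_zero_left, zero_add, Lgrad]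

theorem Lgrady_hamiltonian {U : V3 → ℝ} {z : Phase} (hU : DifferentiableAt ℝ U z.1) :
    Lgrady (fun w => (1/2) * Lprod w.2 w.2 + U w.1) z = z.2 := by
  ext i
  simp only [Lgrady, fderiv_hamiltonian hU, map_zero, add_zero, sgn3_mul_Lprod_single]

theorem fderiv_fst_apply (i : Fin 3) (z v : Phase) :
    fderiv ℝ (fun w : Phase => w.1 i) z v = v.1 i :=
  congrArg (fun L => L v) ((ContinuousLinearMap.proj (R := ℝ) (φ := fun _ : Fin 3 => ℝ) i).comp
    (.fst ℝ V3 V3)).fderiv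

theorem fderiv_snd_apply (i : Fin 3) (z v : Phase) :
    fderiv ℝ (fun w : Phase => w.2 i) z v = v.2 i :=
  congrArg (fun L => L v) ((ContinuousLinearMap.proj (R := ℝ) (φ := fun _ : Fin 3 => ℝ) i).comp
    (.snd ℝ V3 V3)).fderiv

theorem pb_fst_apply (i : Fin 3) (g : Phase → ℝ) (z : Phase) :
    pb (fun w => w.1 i) g z = Lgrady g z i := by
  have hx : Lgradx (fun w => w.1 i) z = fun j => sgn3 j * (Pi.single i 1 : V3) j := by
    ext j
    simp [Lgradx, fderiv_fst_apply, Pi.single_apply, eq_comm]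
  have hy : Lgrady (fun w => w.1 i) z = 0 := by
    ext j
    simp [Lgrady, fderiv_fst_apply]
  rw [pb, hx, hy, Lprod_sgn3_mul_single_left, Lprod_zero_right, sub_zero]

theorem pb_snd_apply (i : Fin 3) (g : Phase → ℝ) (z : Phase) :
    pb (fun w => w.2 i) g z = -Lgradx g z i := by
  have hx : Lgradx (fun w => w.2 i) z = 0 := by
    ext j
    simp [Lgradx, fderiv_snd_apply]
  have hy : Lgrady (fun w => w.2 i) z = fun j => sgn3 j * (Pi.single i 1 : V3) j := by
    ext j
    simp [Lgrady, fderiv_snd_apply, Pi.single_apply, eq_comm]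
  rw [pb, hx, hy, Lprod_zero_left, Lprod_comm, Lprod_sgn3_mul_single_left, zero_sub]

/-- for `H(x,y) = ½⟨y,y⟩_L + U(x)` with smooth `U`, the Hamiltonian
equations with respect to the Dirac–Poisson bracket on `V` are
`ẋ = y`, `ẏ = −∇_L U(x) + x(⟨y,y⟩_L − ⟨x, ∇_L U(x)⟩_L)`. -/
theorem constrained_hamiltonian_equations (U : V3 → ℝ) (hU : ContDiff ℝ (⊤ : ℕ∞) U) (z : Phase)
    (h1 : Lprod z.1 z.1 + 1 = 0) (h2 : Lprod z.1 z.2 = 0) :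
    (∀ i : Fin 3,
      dpb (fun w => w.1 i) (fun w => (1/2) * Lprod w.2 w.2 + U w.1) z = z.2 i) ∧
    (∀ i : Fin 3,
      dpb (fun w => w.2 i) (fun w => (1/2) * Lprod w.2 w.2 + U w.1) z =
        -(Lgrad U z.1 i) + z.1 i * (Lprod z.2 z.2 - Lprod z.1 (Lgrad U z.1))) := by
  have hd : DifferentiableAt ℝ U z.1 := hU.differentiable (by simp) z.1
  have hxx : Lprod z.1 z.1 = -1 := by linarith
  have hc1 : pb (fun w => (1/2) * Lprod w.2 w.2 + U w.1) c1 z = 0 := by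
    rw [pb, Lgrady_c1, Lgradx_c1, Lgrady_hamiltonian hd, Lprod_zero_right, Lprod_smul_left, h2]
    simp
  have hc2 : pb (fun w => (1/2) * Lprod w.2 w.2 + U w.1) c2 z =
      Lprod z.1 (Lgrad U z.1) - Lprod z.2 z.2 := by
    rw [pb, Lgrady_c2, Lgradx_c2, Lgrady_hamiltonian hd, Lgradx_hamiltonian hd, Lprod_comm]
  refine ⟨fun i => ?_, fun i => ?_⟩
  · rw [dpb, hc1, pb_fst_apply, pb_fst_apply i c1, Lgrady_c1, Lgrady_hamiltonian hd]
    simp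
  · rw [dpb, hc1, hc2, hxx, pb_snd_apply, pb_snd_apply i c1, Lgradx_c1, Lgradx_hamiltonian hd]
    simp only [Pi.smul_apply, smul_eq_mul]
    ring
end
end

section
/- Let G_e be the group of matrices R_e(θ) = [[cos θ, −sin θ, 0],[sin θ, cos θ, 0],[0,0,1]], θ ∈ [0,2π), acting diagonally on ℝ³×ℝ³ by (x,y) ↦ (R_e(θ)x, R_e(θ)y). A polynomial p ∈ ℝ[x₁,x₂,x₃,y₁,y₂,y₃] is invariant under this action if and only if p belongs to the subalgebra generated by σ₁ = x₃, σ₂ = y₃, σ₃ = y₁²+y₂²−y₃², σ₄ = x₁y₁+x₂y₂, σ₅ = x₁²+x₂², σ₆ = x₁y₂−x₂y₁. Moreover the kernel of the algebra homomorphism ℝ[w₁,…,w₆] → ℝ[x,y] sending w_i to σ_i is the ideal generated by the single polynomial w₄² + w₆² − w₅(w₃ + w₂²). -/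
open MvPolynomial Real

/-- A monomial in `u, u', v, v'` of total weight zero, where `u, v` have weight one and `u', v'`
have weight minus one, is a product of the four quadratic monomials of weight zero. -/
theorem pow_mul_mem_of_weight_eq {R : Type*} [CommRing R] {S : Submonoid R} {u u' v v' : R}
    (h₁ : u * u' ∈ S) (h₂ : v * v' ∈ S) (h₃ : u * v' ∈ S) (h₄ : v * u' ∈ S)
    {a b c d : ℕ} (h : a + c = b + d) : u ^ a * u' ^ b * v ^ c * v' ^ d ∈ S := by
  rcases le_total a b with hab | hab
  · obtain ⟨k, rfl⟩ := Nat.exists_eq_add_of_le hab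
    obtain rfl : c = k + d := by omega
    have := S.mul_mem (S.mul_mem (S.pow_mem h₁ a) (S.pow_mem h₄ k)) (S.pow_mem h₂ d)
    convert this using 1
    ring
  · obtain ⟨k, rfl⟩ := Nat.exists_eq_add_of_le hab
    obtain rfl : d = k + c := by omega
    have := S.mul_mem (S.mul_mem (S.pow_mem h₁ b) (S.pow_mem h₃ k)) (S.pow_mem h₂ c)
    convert this using 1
    ring

theorem coeff_aeval_C_mul_X {σ R : Type*} [Fintype σ] [CommRing R] (w : σ → R)
    (q : MvPolynomial σ R) (m : σ →₀ ℕ) :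
    coeff m (aeval (fun i => C (w i) * X i) q) = (∏ i, w i ^ m i) * coeff m q := by
  classical
  induction q using MvPolynomial.induction_on' with
  | monomial n r =>
    have : aeval (fun i => C (w i) * X i) (monomial n r) =
        C (∏ i, w i ^ n i) * monomial n r := by
      rw [aeval_monomial, Finsupp.prod_fintype _ _ (by simp)]
      simp only [mul_pow, Finset.prod_mul_distrib, map_prod, map_pow, algebraMap_eq]
      rw [monomial_eq, Finsupp.prod_fintype _ _ (by simp)]
      ring
    rw [this, coeff_C_mul, coeff_monomial]
    split_ifs with h
    · rw [h]
    · simp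
  | add p q hp hq => rw [map_add, coeff_add, coeff_add, hp, hq, mul_add]

theorem C_I_mul_C_I {σ : Type*} : (C Complex.I * C Complex.I : MvPolynomial σ ℂ) = -1 := by
  rw [← C_mul, Complex.I_mul_I]
  simp

/-- The polynomials `map ofReal a + i * map ofReal b` with `a, b` in a real subalgebra `S`. -/
noncomputable def complexification {σ : Type*} (S : Subalgebra ℝ (MvPolynomial σ ℝ)) :
    Subalgebra ℂ (MvPolynomial σ ℂ) where
  carrier := {f | ∃ a ∈ S, ∃ b ∈ S,
    f = map Complex.ofRealHom a + C Complex.I * map Complex.ofRealHom b}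
  mul_mem' := by
    rintro _ _ ⟨a, ha, b, hb, rfl⟩ ⟨c, hc, d, hd, rfl⟩
    refine ⟨a * c - b * d, S.sub_mem (S.mul_mem ha hc) (S.mul_mem hb hd),
      a * d + b * c, S.add_mem (S.mul_mem ha hd) (S.mul_mem hb hc), ?_⟩
    have hI := C_I_mul_C_I (σ := σ)
    simp only [map_sub, map_add, map_mul]
    linear_combination (map Complex.ofRealHom b * map Complex.ofRealHom d) * hI
  add_mem' := by
    rintro _ _ ⟨a, ha, b, hb, rfl⟩ ⟨c, hc, d, hd, rfl⟩
    refine ⟨a + c, S.add_mem ha hc, b + d, S.add_mem hb hd, ?_⟩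
    simp only [map_add]
    ring
  algebraMap_mem' z := by
    refine ⟨C z.re, S.algebraMap_mem _, C z.im, S.algebraMap_mem _, ?_⟩
    simp only [map_C, Complex.ofRealHom_eq_coe, algebraMap_eq, ← C_mul, ← C_add]
    rw [mul_comm, Complex.re_add_im]

theorem map_ofReal_mem_complexification {σ : Type*} {S : Subalgebra ℝ (MvPolynomial σ ℝ)}
    {a : MvPolynomial σ ℝ} (ha : a ∈ S) : map Complex.ofRealHom a ∈ complexification S :=
  ⟨a, ha, 0, S.zero_mem, by simp⟩

theorem mem_of_map_ofReal_mem_complexification {σ : Type*}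
    {S : Subalgebra ℝ (MvPolynomial σ ℝ)} {p : MvPolynomial σ ℝ}
    (hp : map Complex.ofRealHom p ∈ complexification S) : p ∈ S := by
  obtain ⟨a, ha, b, hb, h⟩ := hp
  suffices p = a from this ▸ ha
  ext m
  have := congrArg Complex.re (congrArg (coeff m) h)
  simpa [coeff_map] using this

theorem exists_exp_pow_mul_exp_neg_pow_ne_one {m n : ℕ} (h : m ≠ n) :
    ∃ θ : ℝ, (Complex.cos θ + Complex.I * Complex.sin θ) ^ m *
      (Complex.cos θ - Complex.I * Complex.sin θ) ^ n ≠ 1 := by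
  have hd : (m : ℂ) - n ≠ 0 := sub_ne_zero.2 (by exact_mod_cast h)
  refine ⟨π / (m - n), ?_⟩
  set θ : ℝ := π / (m - n) with hθ
  have h₁ : Complex.cos θ + Complex.I * Complex.sin θ = Complex.exp (θ * Complex.I) := by
    rw [Complex.exp_mul_I]; ring
  have h₂ : Complex.cos θ - Complex.I * Complex.sin θ = Complex.exp (-θ * Complex.I) := by
    rw [Complex.exp_mul_I, Complex.cos_neg, Complex.sin_neg]; ring
  rw [h₁, h₂, ← Complex.exp_nat_mul, ← Complex.exp_nat_mul, ← Complex.exp_add]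
  have : (m : ℂ) * (θ * Complex.I) + n * (-θ * Complex.I) = π * Complex.I := by
    rw [hθ]
    push_cast
    field_simp
    ring
  rw [this, Complex.exp_pi_mul_I]
  norm_num

/-- Simultaneous rotation of the coordinate pairs `(X 0, X 1)` and `(X 3, X 4)`. -/
noncomputable def pairRotation {R : Type*} [CommRing R] (c s : R) :
    Fin 6 → MvPolynomial (Fin 6) R :=
  ![C c * X 0 - C s * X 1, C s * X 0 + C c * X 1, X 2,
    C c * X 3 - C s * X 4, C s * X 3 + C c * X 4, X 5]

/-- The substitution expressing the Cartesian coordinates in eigencoordinates of the rotations. -/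
noncomputable def fromEigen : Fin 6 → MvPolynomial (Fin 6) ℂ :=
  ![C (1 / 2) * (X 0 + X 1), C (-Complex.I / 2) * (X 0 - X 1), X 2,
    C (1 / 2) * (X 3 + X 4), C (-Complex.I / 2) * (X 3 - X 4), X 5]

/-- The eigencoordinates of the rotations in terms of the Cartesian coordinates. -/
noncomputable def toEigen : Fin 6 → MvPolynomial (Fin 6) ℂ :=
  ![X 0 + C Complex.I * X 1, X 0 - C Complex.I * X 1, X 2,
    X 3 + C Complex.I * X 4, X 3 - C Complex.I * X 4, X 5]

theorem two_mul_C_half {σ : Type*} : (2 * C (1 / 2) : MvPolynomial σ ℂ) = 1 := by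
  rw [show (2 : MvPolynomial σ ℂ) = C 2 from (map_ofNat C 2).symm, ← C_mul]
  norm_num

theorem C_neg_I_div_two {σ : Type*} :
    (C (-Complex.I / 2) : MvPolynomial σ ℂ) = -(C Complex.I * C (1 / 2)) := by
  rw [← C_mul, ← C_neg]
  congr 1
  ring

theorem aeval_toEigen_aeval_fromEigen (p : MvPolynomial (Fin 6) ℂ) :
    aeval toEigen (aeval fromEigen p) = p := by
  suffices (aeval toEigen).comp (aeval fromEigen) = AlgHom.id ℂ (MvPolynomial (Fin 6) ℂ) from
    DFunLike.congr_fun this p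
  have hI := C_I_mul_C_I (σ := Fin 6)
  have h2 := two_mul_C_half (σ := Fin 6)
  refine algHom_ext fun i => ?_
  fin_cases i <;>
    simp [-one_div, fromEigen, toEigen, algHom_C, algebraMap_eq, C_neg_I_div_two]
  · linear_combination X 0 * h2
  · linear_combination X 1 * h2 - 2 * C (1 / 2) * X 1 * hI
  · linear_combination X 3 * h2
  · linear_combination X 4 * h2 - 2 * C (1 / 2) * X 4 * hI

theorem aeval_fromEigen_aeval_rotation (c s : ℂ) (p : MvPolynomial (Fin 6) ℂ) :
    aeval fromEigen (aeval (pairRotation c s) p) =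
      aeval (fun i => C ((![c + Complex.I * s, c - Complex.I * s, 1,
        c + Complex.I * s, c - Complex.I * s, 1] : Fin 6 → ℂ) i) * X i) (aeval fromEigen p) := by
  set w : Fin 6 → ℂ := ![c + Complex.I * s, c - Complex.I * s, 1,
        c + Complex.I * s, c - Complex.I * s, 1] with hw
  suffices (aeval fromEigen).comp (aeval (pairRotation c s)) =
      (aeval (fun i => C (w i) * X i)).comp (aeval fromEigen) from DFunLike.congr_fun this p
  have hI := C_I_mul_C_I (σ := Fin 6)
  refine algHom_ext fun i => ?_
  fin_cases i <;>
    simp [-one_div, fromEigen, pairRotation, hw, algHom_C, algebraMap_eq, C_neg_I_div_two]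
  · ring
  · linear_combination C (1 / 2) * C s * (X 0 + X 1) * hI
  · ring
  · linear_combination C (1 / 2) * C s * (X 3 + X 4) * hI

theorem map_aeval_rotation (c s : ℝ) (p : MvPolynomial (Fin 6) ℝ) :
    map Complex.ofRealHom (aeval (pairRotation c s) p) =
      aeval (pairRotation (c : ℂ) (s : ℂ)) (map Complex.ofRealHom p) := by
  induction p using MvPolynomial.induction_on with
  | C a => simp [algebraMap_eq]
  | add p q hp hq => simp only [map_add, hp, hq]
  | mul_X p i hp =>
    simp only [map_mul, hp, aeval_X, map_X]
    congr 1
    fin_cases i <;> simp [pairRotation]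

/-- Generators of the algebra of rotation invariants. -/
noncomputable def invariantGenerators : Fin 6 → MvPolynomial (Fin 6) ℝ :=
  ![X 2, X 5, X 3 ^ 2 + X 4 ^ 2 - X 5 ^ 2, X 0 * X 3 + X 1 * X 4,
    X 0 ^ 2 + X 1 ^ 2, X 0 * X 4 - X 1 * X 3]

theorem mem_adjoin_of_aeval_rotation_eq {p : MvPolynomial (Fin 6) ℝ}
    (hp : ∀ θ : ℝ, aeval (pairRotation (Real.cos θ) (Real.sin θ)) p = p) :
    p ∈ Algebra.adjoin ℝ (Set.range invariantGenerators) := by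
  set S := Algebra.adjoin ℝ (Set.range invariantGenerators)
  have hS (i : Fin 6) : invariantGenerators i ∈ S := Algebra.subset_adjoin ⟨i, rfl⟩
  apply mem_of_map_ofReal_mem_complexification
  set T := complexification S
  have hT (i : Fin 6) : map Complex.ofRealHom (invariantGenerators i) ∈ T :=
    map_ofReal_mem_complexification (hS i)
  have hCT (z : ℂ) : C z ∈ T := T.algebraMap_mem z
  have hI := C_I_mul_C_I (σ := Fin 6)
  have h2 : X 2 ∈ T := by simpa [invariantGenerators] using hT 0
  have h5 : X 5 ∈ T := by simpa [invariantGenerators] using hT 1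
  have hdot : X 0 * X 3 + X 1 * X 4 ∈ T := by simpa [invariantGenerators] using hT 3
  have hcross : X 0 * X 4 - X 1 * X 3 ∈ T := by simpa [invariantGenerators] using hT 5
  have hx : X 0 ^ 2 + X 1 ^ 2 ∈ T := by simpa [invariantGenerators] using hT 4
  have hy : X 3 ^ 2 + X 4 ^ 2 ∈ T := by
    have : X 3 ^ 2 + X 4 ^ 2 - X 5 ^ 2 ∈ T := by simpa [invariantGenerators] using hT 2
    simpa using T.add_mem this (T.pow_mem h5 2)
  set q := aeval fromEigen (map Complex.ofRealHom p) with hq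
  have hweight (m : Fin 6 →₀ ℕ) (hm : coeff m q ≠ 0) : m 0 + m 3 = m 1 + m 4 := by
    by_contra h
    obtain ⟨θ, hθ⟩ := exists_exp_pow_mul_exp_neg_pow_ne_one h
    have key := congrArg (fun f => coeff m (aeval fromEigen (map Complex.ofRealHom f))) (hp θ)
    simp only [map_aeval_rotation, aeval_fromEigen_aeval_rotation, coeff_aeval_C_mul_X] at key
    rw [← hq, mul_eq_right₀ hm] at key
    apply hθ
    rw [← key]
    simp [Fin.prod_univ_six]
    ring
  rw [← aeval_toEigen_aeval_fromEigen (map Complex.ofRealHom p), ← hq, q.as_sum, map_sum]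
  refine T.sum_mem fun m hm => ?_
  rw [aeval_monomial, Finsupp.prod_fintype _ _ (by simp)]
  refine T.mul_mem (T.algebraMap_mem _) ?_
  have := pow_mul_mem_of_weight_eq (S := T.toSubmonoid) (u := toEigen 0) (u' := toEigen 1)
    (v := toEigen 3) (v' := toEigen 4) ?_ ?_ ?_ ?_ (hweight m (mem_support_iff.1 hm))
  · convert T.mul_mem this (T.mul_mem (T.pow_mem h2 (m 2)) (T.pow_mem h5 (m 5))) using 1
    simp [Fin.prod_univ_six, toEigen]
    ring
  · change _ ∈ T
    convert hx using 1
    simp [toEigen]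
    linear_combination -X 1 ^ 2 * hI
  · change _ ∈ T
    convert hy using 1
    simp [toEigen]
    linear_combination -X 4 ^ 2 * hI
  · change _ ∈ T
    convert T.sub_mem hdot (T.mul_mem (hCT Complex.I) hcross) using 1
    simp [toEigen]
    linear_combination -X 1 * X 4 * hI
  · change _ ∈ T
    convert T.add_mem hdot (T.mul_mem (hCT Complex.I) hcross) using 1
    simp [toEigen]
    linear_combination -X 1 * X 4 * hI

/-- Modulo the relation, every polynomial is affine in the last variable. -/
theorem exists_sub_mem_span_relation (F : MvPolynomial (Fin 6) ℝ) :
    ∃ A B : MvPolynomial (Fin 5) ℝ,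
      F - (rename Fin.castSucc A + X 5 * rename Fin.castSucc B) ∈
        Ideal.span {(X 3 ^ 2 + X 5 ^ 2 - X 4 * (X 2 + X 1 ^ 2) : MvPolynomial (Fin 6) ℝ)} := by
  induction F using MvPolynomial.induction_on with
  | C a => exact ⟨C a, 0, by simp⟩
  | add p q hp hq =>
    obtain ⟨A, B, h⟩ := hp
    obtain ⟨A', B', h'⟩ := hq
    refine ⟨A + A', B + B', ?_⟩
    convert Ideal.add_mem _ h h' using 1
    simp only [map_add]
    ring
  | mul_X p i hp =>
    obtain ⟨A, B, h⟩ := hp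
    induction i using Fin.lastCases with
    | cast j =>
      refine ⟨A * X j, B * X j, ?_⟩
      convert Ideal.mul_mem_right (X j.castSucc) _ h using 1
      simp only [map_mul, rename_X]
      ring
    | last =>
      refine ⟨(X 4 * (X 2 + X 1 ^ 2) - X 3 ^ 2) * B, A, ?_⟩
      convert Ideal.add_mem _ (Ideal.mul_mem_right (X 5) _ h)
        (Ideal.mul_mem_left _ (rename Fin.castSucc B)
          (Ideal.subset_span (Set.mem_singleton _))) using 1
      simp
      ring

theorem eval_eq_zero_of_aeval_invariantGenerators_eq_zero {A B : MvPolynomial (Fin 5) ℝ}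
    (h : aeval invariantGenerators (rename Fin.castSucc A + X 5 * rename Fin.castSucc B) = 0)
    {s : Fin 5 → ℝ} (h4 : 0 < s 4) (hs : s 3 ^ 2 < s 4 * (s 2 + s 1 ^ 2)) :
    eval s A = 0 ∧ eval s B = 0 := by
  set r := √(s 4) with hr
  set c := √(s 4 * (s 2 + s 1 ^ 2) - s 3 ^ 2) with hc
  have hr0 : 0 < r := Real.sqrt_pos.2 h4
  have hr2 : r ^ 2 = s 4 := Real.sq_sqrt h4.le
  have hc0 : 0 < c := Real.sqrt_pos.2 (sub_pos.2 hs)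
  have hc2 : c ^ 2 = s 4 * (s 2 + s 1 ^ 2) - s 3 ^ 2 := Real.sq_sqrt (sub_pos.2 hs).le
  have key (e : ℝ) (he : e ^ 2 = c ^ 2) : eval s A + e * eval s B = 0 := by
    have hz := congrArg (eval (![r, 0, s 0, s 3 / r, e / r, s 1] : Fin 6 → ℝ)) h
    have hσ : (fun i : Fin 5 => eval (![r, 0, s 0, s 3 / r, e / r, s 1] : Fin 6 → ℝ)
        (invariantGenerators i.castSucc)) = s := by
      funext i
      fin_cases i <;> simp [invariantGenerators]
      · field_simp
        rw [he, hc2, hr2]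
        ring
      · field_simp
      · exact hr2
    have hcomp (P : MvPolynomial (Fin 5) ℝ) :
        eval (![r, 0, s 0, s 3 / r, e / r, s 1] : Fin 6 → ℝ)
          (aeval (invariantGenerators ∘ Fin.castSucc) P) = eval s P := by
      conv_rhs => rw [← hσ]
      induction P using MvPolynomial.induction_on with
      | C a => simp [algebraMap_eq]
      | add p q hp hq => simp only [map_add, hp, hq]
      | mul_X p i hp => simp only [map_mul, hp, aeval_X, eval_X, Function.comp_apply]
    rw [map_add, map_mul, aeval_rename, aeval_rename, map_add, map_mul, hcomp, hcomp] at hz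
    have h5 : eval (![r, 0, s 0, s 3 / r, e / r, s 1] : Fin 6 → ℝ)
        (aeval invariantGenerators (X 5 : MvPolynomial (Fin 6) ℝ)) = e := by
      simp [invariantGenerators]
      field_simp
    rwa [h5, map_zero] at hz
  have h₁ := key c rfl
  have h₂ := key (-c) (by ring)
  have hB : c * eval s B = 0 := by linarith
  exact ⟨by linarith, (mul_eq_zero.1 hB).resolve_left hc0.ne'⟩

theorem ker_aeval_invariantGenerators :
    RingHom.ker (aeval invariantGenerators :
        MvPolynomial (Fin 6) ℝ →ₐ[ℝ] MvPolynomial (Fin 6) ℝ)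
      = Ideal.span {X 3 ^ 2 + X 5 ^ 2 - X 4 * (X 2 + X 1 ^ 2)} := by
  have hle : Ideal.span {(X 3 ^ 2 + X 5 ^ 2 - X 4 * (X 2 + X 1 ^ 2) : MvPolynomial (Fin 6) ℝ)} ≤
      RingHom.ker (aeval invariantGenerators :
        MvPolynomial (Fin 6) ℝ →ₐ[ℝ] MvPolynomial (Fin 6) ℝ) := by
    rw [Ideal.span_le, Set.singleton_subset_iff]
    simp [invariantGenerators, RingHom.mem_ker]
    ring
  refine le_antisymm (fun F hF => ?_) hle
  obtain ⟨A, B, h⟩ := exists_sub_mem_span_relation F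
  have hAB : aeval invariantGenerators
      (rename Fin.castSucc A + X 5 * rename Fin.castSucc B) = 0 := by
    have h' := hle h
    rw [RingHom.mem_ker] at hF h'
    rw [map_sub, hF, zero_sub, neg_eq_zero] at h'
    exact h'
  let box : Fin 5 → Set ℝ :=
    ![Set.univ, Set.univ, Set.Ici 2, Set.Icc 0 1, Set.Ici 1]
  have hbox (i : Fin 5) : (box i).Infinite := by
    fin_cases i
    · exact Set.infinite_univ
    · exact Set.infinite_univ
    · exact Set.Ici_infinite _
    · exact Set.Icc_infinite zero_lt_one
    · exact Set.Ici_infinite _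
  have hzero (s : Fin 5 → ℝ) (hs : s ∈ Set.univ.pi box) : eval s A = 0 ∧ eval s B = 0 := by
    have h2 : 2 ≤ s 2 := hs 2 trivial
    have h3 : 0 ≤ s 3 ∧ s 3 ≤ 1 := hs 3 trivial
    have h4 : 1 ≤ s 4 := hs 4 trivial
    refine eval_eq_zero_of_aeval_invariantGenerators_eq_zero hAB (by linarith) ?_
    nlinarith [sq_nonneg (s 1)]
  have hA : A = 0 := funext_set box hbox fun s hs => by simpa using (hzero s hs).1
  have hB : B = 0 := funext_set box hbox fun s hs => by simpa using (hzero s hs).2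
  simpa [hA, hB] using h

theorem eval_aeval_rotation (c s : ℝ) (z : Fin 6 → ℝ) (p : MvPolynomial (Fin 6) ℝ) :
    eval z (aeval (pairRotation c s) p) =
      eval (![c * z 0 - s * z 1, s * z 0 + c * z 1, z 2,
        c * z 3 - s * z 4, s * z 3 + c * z 4, z 5] : Fin 6 → ℝ) p := by
  induction p using MvPolynomial.induction_on with
  | C a => simp [algebraMap_eq]
  | add p q hp hq => simp only [map_add, hp, hq]
  | mul_X p i hp =>
    simp only [map_mul, hp, aeval_X, eval_X]
    congr 1
    fin_cases i <;> simp [pairRotation]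

theorem aeval_rotation_eq_of_mem_adjoin {c s : ℝ} (h : c ^ 2 + s ^ 2 = 1)
    {p : MvPolynomial (Fin 6) ℝ}
    (hp : p ∈ Algebra.adjoin ℝ (Set.range invariantGenerators)) :
    aeval (pairRotation c s) p = p := by
  suffices Algebra.adjoin ℝ (Set.range invariantGenerators) ≤
      AlgHom.equalizer (aeval (pairRotation c s)) (AlgHom.id ℝ _) from this hp
  have hC : (C c ^ 2 + C s ^ 2 : MvPolynomial (Fin 6) ℝ) = 1 := by
    rw [← C_pow, ← C_pow, ← C_add, h, C_1]
  rw [Algebra.adjoin_le_iff]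
  rintro _ ⟨i, rfl⟩
  fin_cases i <;> simp [invariantGenerators, pairRotation]
  · linear_combination (X 3 ^ 2 + X 4 ^ 2) * hC
  · linear_combination (X 0 * X 3 + X 1 * X 4) * hC
  · linear_combination (X 0 ^ 2 + X 1 ^ 2) * hC
  · linear_combination (X 0 * X 4 - X 1 * X 3) * hC

open MvPolynomial Real

/-- invariants of the elliptic rotation group acting diagonally on
`ℝ³ × ℝ³` (coordinates `x = (z₀,z₁,z₂)`, `y = (z₃,z₄,z₅)`).  A polynomial is invariant
iff it lies in the subalgebra generated by `σ₁ = x₃, σ₂ = y₃, σ₃ = y₁²+y₂²−y₃²,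
σ₄ = x₁y₁+x₂y₂, σ₅ = x₁²+x₂², σ₆ = x₁y₂−x₂y₁`, and the ideal of relations between the
`σᵢ` is generated by `w₄² + w₆² − w₅(w₃ + w₂²)`. -/
theorem elliptic_invariants :
    (∀ p : MvPolynomial (Fin 6) ℝ,
      (∀ θ : ℝ, ∀ z : Fin 6 → ℝ,
        eval (![Real.cos θ * z 0 - Real.sin θ * z 1,
                Real.sin θ * z 0 + Real.cos θ * z 1,
                z 2,
                Real.cos θ * z 3 - Real.sin θ * z 4,
                Real.sin θ * z 3 + Real.cos θ * z 4,
                z 5] : Fin 6 → ℝ) p = eval z p)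
        ↔ p ∈ Algebra.adjoin ℝ
            ({X 2, X 5, X 3 ^ 2 + X 4 ^ 2 - X 5 ^ 2, X 0 * X 3 + X 1 * X 4,
              X 0 ^ 2 + X 1 ^ 2, X 0 * X 4 - X 1 * X 3} :
              Set (MvPolynomial (Fin 6) ℝ))) ∧
    RingHom.ker (aeval
        (![X 2, X 5, X 3 ^ 2 + X 4 ^ 2 - X 5 ^ 2, X 0 * X 3 + X 1 * X 4,
           X 0 ^ 2 + X 1 ^ 2, X 0 * X 4 - X 1 * X 3] :
          Fin 6 → MvPolynomial (Fin 6) ℝ) :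
        MvPolynomial (Fin 6) ℝ →ₐ[ℝ] MvPolynomial (Fin 6) ℝ)
      = Ideal.span {X 3 ^ 2 + X 5 ^ 2 - X 4 * (X 2 + X 1 ^ 2)} := by
  refine ⟨fun p => ?_, ker_aeval_invariantGenerators⟩
  have hrange : ({X 2, X 5, X 3 ^ 2 + X 4 ^ 2 - X 5 ^ 2, X 0 * X 3 + X 1 * X 4,
      X 0 ^ 2 + X 1 ^ 2, X 0 * X 4 - X 1 * X 3} : Set (MvPolynomial (Fin 6) ℝ)) =
      Set.range invariantGenerators := by
    ext f
    simp [invariantGenerators]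
    tauto
  rw [hrange]
  constructor
  · intro h
    refine mem_adjoin_of_aeval_rotation_eq fun θ => MvPolynomial.funext fun z => ?_
    rw [eval_aeval_rotation, h]
  · intro h θ z
    rw [← eval_aeval_rotation, aeval_rotation_eq_of_mem_adjoin (Real.cos_sq_add_sin_sq θ) h]
end

section
/- Let Ũ : ℝ → ℝ be smooth. If w : I → ℝ³ is a differentiable solution of the reduced elliptic system ẇ₁ = w₂, ẇ₂ = w₁w₃ + (1−w₁²)Ũ′(w₁), ẇ₃ = −2w₂Ũ′(w₁) on an interval I, then the functions j²(w) = (w₁²−1)w₃ − w₂² and h(w) = ½w₃ + Ũ(w₁) are constant along the solution. -/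
/-- A function with vanishing derivative on an order-connected set is constant there. -/
theorem Set.OrdConnected.eq_of_hasDerivAt_zero {f : ℝ → ℝ} {I : Set ℝ} (hI : I.OrdConnected)
    (hf : ∀ x ∈ I, HasDerivAt f 0 x) {t s : ℝ} (ht : t ∈ I) (hs : s ∈ I) : f t = f s := by
  have h := hI.convex.norm_image_sub_le_of_norm_hasDerivWithin_le (C := 0)
    (fun x hx => (hf x hx).hasDerivWithinAt) (fun _ _ => norm_zero.le) hs ht
  rw [zero_mul, norm_le_zero_iff, sub_eq_zero] at h
  exact h

/-- along any differentiable solution of the reduced elliptic system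
`ẇ₁ = w₂`, `ẇ₂ = w₁w₃ + (1−w₁²)Ũ′(w₁)`, `ẇ₃ = −2w₂Ũ′(w₁)` on an interval `I`,
the functions `j² = (w₁²−1)w₃ − w₂²` and `h = ½w₃ + Ũ(w₁)` are constant. -/
theorem elliptic_reduced_first_integrals (Ut : ℝ → ℝ) (hUt : ContDiff ℝ (⊤ : ℕ∞) Ut)
    (I : Set ℝ) (hI : I.OrdConnected) (w1 w2 w3 : ℝ → ℝ)
    (h1 : ∀ t ∈ I, HasDerivAt w1 (w2 t) t)
    (h2 : ∀ t ∈ I, HasDerivAt w2 (w1 t * w3 t + (1 - (w1 t)^2) * deriv Ut (w1 t)) t)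
    (h3 : ∀ t ∈ I, HasDerivAt w3 (-2 * w2 t * deriv Ut (w1 t)) t) :
    ∀ t ∈ I, ∀ s ∈ I,
      ((w1 t)^2 - 1) * w3 t - (w2 t)^2 = ((w1 s)^2 - 1) * w3 s - (w2 s)^2 ∧
      (1/2) * w3 t + Ut (w1 t) = (1/2) * w3 s + Ut (w1 s) := by
  intro t ht s hs
  constructor
  · refine hI.eq_of_hasDerivAt_zero
      (f := fun x => ((w1 x) ^ 2 - 1) * w3 x - (w2 x) ^ 2) (fun x hx => ?_) ht hs
    refine ((((h1 x hx).fun_pow 2).sub_const 1).fun_mul (h3 x hx)).fun_sub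
      ((h2 x hx).fun_pow 2) |>.congr_deriv ?_
    push_cast
    ring
  · refine hI.eq_of_hasDerivAt_zero
      (f := fun x => (1 / 2) * w3 x + Ut (w1 x)) (fun x hx => ?_) ht hs
    have hU : HasDerivAt Ut (deriv Ut (w1 x)) (w1 x) :=
      (hUt.differentiable (by simp) (w1 x)).hasDerivAt
    refine ((h3 x hx).const_mul (1 / 2)).fun_add (hU.comp x (h1 x hx)) |>.congr_deriv ?_
    ring
end
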